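/- arXiv:1704.08538 — 2 statements merged into one kernel-verified Lean document; each statement's English description precedes it below -/
import Mathlib

section
/- Let n ∈ ℕ and let C_* and D_* be normed chain complexes (chain complexes of normed abelian groups with bounded differentials). Let f : C_* → D_* be a chain homotopy equivalence with chain homotopy inverse g : D_* → C_*, and let h^C be a chain homotopy from id_{C_*} to g ∘ f (so ∂_{m+1} ∘ h^C_m + h^C_{m-1} ∘ ∂_m = g_m ∘ f_m − id_{C_m} for all m). Suppose that the maps f_n, g_{n+1} and h^C_n are bounded, say with operator norms at most K, and that D_* satisfies the uniform boundary condition in degree n with constant K. Then C_* satisfies the uniform boundary condition in degree n; more precisely, every null-homologous cycle c ∈ C_n admits a filling b ∈ C_{n+1} with ∂b = c and ‖b‖ ≤ (K³ + K)·‖c‖. -/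
/--
Uniform boundary condition and chain homotopy equivalences.

Normed chain complexes are modelled as families of normed abelian groups
`C i` (indexed over `ℤ`) together with bounded differentials
`dC i : C (i+1) →+ C i` squaring to zero. Given a chain homotopy equivalence
`f : C → D` with homotopy inverse `g` and chain homotopies `hC` (from `id_C`
to `g ∘ f`) and `hD` (from `id_D` to `f ∘ g`), such that `f n`, `g (n+1)` and
`hC n` are bounded with operator norms at most `K`, and `D` satisfies the
uniform boundary condition in degree `n` with constant `K`, then every
null-homologous cycle `c ∈ C n` admits a filling `b ∈ C (n+1)` with
`∂ b = c` and `‖b‖ ≤ (K^3 + K) * ‖c‖`.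
-/
theorem ubc_of_chain_homotopy_equivalence
    (C D : ℤ → Type*)
    [∀ i, NormedAddCommGroup (C i)] [∀ i, NormedAddCommGroup (D i)]
    -- differentials
    (dC : ∀ i : ℤ, C (i + 1) →+ C i) (dD : ∀ i : ℤ, D (i + 1) →+ D i)
    (hdC : ∀ (i : ℤ) (x : C (i + 1 + 1)), dC i (dC (i + 1) x) = 0)
    (hdD : ∀ (i : ℤ) (x : D (i + 1 + 1)), dD i (dD (i + 1) x) = 0)
    -- the differentials are bounded
    (hdCbdd : ∀ i : ℤ, ∃ L : ℝ, 0 < L ∧ ∀ x : C (i + 1), ‖dC i x‖ ≤ L * ‖x‖)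
    (hdDbdd : ∀ i : ℤ, ∃ L : ℝ, 0 < L ∧ ∀ x : D (i + 1), ‖dD i x‖ ≤ L * ‖x‖)
    -- chain maps f : C → D and g : D → C
    (f : ∀ i : ℤ, C i →+ D i) (g : ∀ i : ℤ, D i →+ C i)
    (hf : ∀ (i : ℤ) (x : C (i + 1)), dD i (f (i + 1) x) = f i (dC i x))
    (hg : ∀ (i : ℤ) (x : D (i + 1)), dC i (g (i + 1) x) = g i (dD i x))
    -- chain homotopies: hC from id_C to g ∘ f, hD from id_D to f ∘ g
    (hC : ∀ i : ℤ, C i →+ C (i + 1)) (hD : ∀ i : ℤ, D i →+ D (i + 1))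
    (hhC : ∀ (i : ℤ) (x : C (i + 1)),
      dC (i + 1) (hC (i + 1) x) + hC i (dC i x) = g (i + 1) (f (i + 1) x) - x)
    (hhD : ∀ (i : ℤ) (x : D (i + 1)),
      dD (i + 1) (hD (i + 1) x) + hD i (dD i x) = f (i + 1) (g (i + 1) x) - x)
    -- degree n and the bound K
    (n : ℤ) (K : ℝ) (hK : 0 < K)
    (hfbdd : ∀ x : C n, ‖f n x‖ ≤ K * ‖x‖)
    (hgbdd : ∀ x : D (n + 1), ‖g (n + 1) x‖ ≤ K * ‖x‖)
    (hhCbdd : ∀ x : C n, ‖hC n x‖ ≤ K * ‖x‖)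
    -- D satisfies n-UBC with constant K
    (hUBC : ∀ c : D n, (∃ a : D (n + 1), dD n a = c) →
      ∃ b : D (n + 1), dD n b = c ∧ ‖b‖ ≤ K * ‖c‖) :
    -- conclusion: C satisfies n-UBC with constant K^3 + K
    ∀ c : C n, (∃ a : C (n + 1), dC n a = c) →
      ∃ b : C (n + 1), dC n b = c ∧ ‖b‖ ≤ (K ^ 3 + K) * ‖c‖ := by
  rintro c ⟨a, rfl⟩
  obtain ⟨b, hb, hbK⟩ := hUBC (f n (dC n a)) ⟨f (n + 1) a, hf n a⟩
  have homotopy : dC n (hC n (dC n a)) = g n (f n (dC n a)) - dC n a := by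
    have h := congrArg (dC n) (hhC n a)
    rwa [map_add, map_sub, hdC, zero_add, hg, hf] at h
  refine ⟨g (n + 1) b - hC n (dC n a), ?_, ?_⟩
  · rw [map_sub, hg, hb, homotopy, sub_sub_cancel]
  · calc ‖g (n + 1) b - hC n (dC n a)‖
        ≤ ‖g (n + 1) b‖ + ‖hC n (dC n a)‖ := norm_sub_le _ _
      _ ≤ K * (K * (K * ‖dC n a‖)) + K * ‖dC n a‖ := by
          gcongr
          · refine (hgbdd b).trans ?_
            gcongr
            refine hbK.trans ?_
            gcongr
            exact hfbdd _
          · exact hhCbdd _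
      _ = (K ^ 3 + K) * ‖dC n a‖ := by ring
end

section
/- Let Γ be a countable group and let α : Γ ↷ (Z, μ) be a standard Γ-space. Set A := L^∞(Z, μ; ℤ) with the right Γ-action (f·γ)(x) := f(γ·x). Then the canonical map A^Γ → A_Γ from the Γ-invariants of A to the Γ-coinvariants of A is injective. Equivalently: if f ∈ A satisfies f·γ = f (μ-almost everywhere) for every γ ∈ Γ, and f lies in the additive subgroup of A generated by the elements g·γ − g with g ∈ A and γ ∈ Γ, then f = 0 in A (i.e., f = 0 μ-almost everywhere). -/
open MeasureTheory

/-- An essentially bounded measurable integer-valued function is integrable, as a real function,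
for a finite measure. -/
theorem integrable_intCast_of_ae_abs_le {Z : Type*} [MeasurableSpace Z] {μ : Measure Z}
    [IsFiniteMeasure μ] {g : Z → ℤ} (hg : Measurable g) {c : ℤ} (hc : ∀ᵐ z ∂μ, |g z| ≤ c) :
    Integrable (fun z => (g z : ℝ)) μ := by
  refine Integrable.of_bound (measurable_from_top.comp hg).aestronglyMeasurable (c : ℝ) ?_
  filter_upwards [hc] with z hz
  rw [Real.norm_eq_abs]
  exact_mod_cast hz

/-- The product of two integer-valued functions that are measurable and essentially bounded is
integrable, as a real function, for a finite measure. -/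
theorem integrable_intCast_mul_of_ae_abs_le {Z : Type*} [MeasurableSpace Z] {μ : Measure Z}
    [IsFiniteMeasure μ] {f g : Z → ℤ} (hf : Measurable f) (hg : Measurable g) {b c : ℤ}
    (hb : ∀ᵐ z ∂μ, |f z| ≤ b) (hc : ∀ᵐ z ∂μ, |g z| ≤ c) :
    Integrable (fun z => (f z : ℝ) * g z) μ := by
  have h : Integrable (fun z => ((f z * g z : ℤ) : ℝ)) μ := by
    refine integrable_intCast_of_ae_abs_le (hf.mul hg) (c := b * c) ?_
    filter_upwards [hb, hc] with z hz hz'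
    rw [abs_mul]
    exact mul_le_mul hz hz' (abs_nonneg _) ((abs_nonneg _).trans hz)
  simpa using h

/-- A function invariant under a measure-preserving map `T` is orthogonal to every
coboundary `g ∘ T - g`. -/
theorem integral_mul_comp_sub_eq_zero {Z : Type*} [MeasurableSpace Z] {μ : Measure Z}
    {T : Z → Z} (hT : MeasurePreserving T μ μ) {f g : Z → ℝ}
    (hfT : (fun z => f (T z)) =ᵐ[μ] f) (hfg : Integrable (fun z => f z * g z) μ) :
    Integrable (fun z => f z * (g (T z) - g z)) μ ∧ ∫ z, f z * (g (T z) - g z) ∂μ = 0 := by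
  have hcomp : Integrable (fun z => f (T z) * g (T z)) μ := hT.integrable_comp_of_integrable hfg
  have heq : (fun z => f z * (g (T z) - g z)) =ᵐ[μ]
      fun z => f (T z) * g (T z) - f z * g z := by
    filter_upwards [hfT] with z hz
    rw [hz, mul_sub]
  refine ⟨(hcomp.sub hfg).congr heq.symm, ?_⟩
  have hint : ∫ z, f (T z) * g (T z) ∂μ = ∫ z, f z * g z ∂μ := by
    conv_rhs => rw [← hT.map_eq]
    refine (integral_map (f := fun z => f z * g z) hT.aemeasurable ?_).symm
    rw [hT.map_eq]
    exact hfg.aestronglyMeasurable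
  rw [integral_congr_ae heq, integral_sub hcomp hfg, hint, sub_self]

/--
The canonical map `A^Γ → A_Γ` is injective for
`A = L^∞(Z, μ; ℤ)`.

Here `α : Γ ↷ (Z, μ)` is a standard `Γ`-space: `Z` is a standard Borel
space, `μ` a probability measure, and the countable group `Γ` acts on `Z`
measurably and measure-preservingly.  Elements of `A` are represented by
measurable essentially bounded functions `Z → ℤ`, identified when they
agree `μ`-almost everywhere; the right `Γ`-action is `(f·γ)(x) = f(γ·x)`.

In these terms: if `f` is `Γ`-invariant (`f·γ = f` a.e. for every `γ`)
and `f` lies (in `A`, i.e. up to a.e. equality) in the additive subgroup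
generated by the elements `g·γ − g`, i.e. `f` agrees a.e. with a finite sum
`∑ i, (gᵢ·γᵢ − gᵢ)`, then `f = 0` in `A`, i.e. `f = 0` `μ`-a.e.
-/
theorem invariants_to_coinvariants_injective
    {Z : Type*} [MeasurableSpace Z] [StandardBorelSpace Z]
    (μ : Measure Z) [IsProbabilityMeasure μ]
    (Γ : Type*) [Group Γ] [Countable Γ] [MulAction Γ Z]
    (hact : ∀ γ : Γ, MeasurePreserving (fun z => γ • z) μ μ)
    (f : Z → ℤ) (hfmeas : Measurable f)
    (hfbdd : ∃ c : ℤ, ∀ᵐ z ∂μ, |f z| ≤ c)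
    (hfinv : ∀ γ : Γ, (fun z => f (γ • z)) =ᵐ[μ] f)
    (hfsub : ∃ (k : ℕ) (g : Fin k → Z → ℤ) (γ : Fin k → Γ),
      (∀ i, Measurable (g i)) ∧
      (∀ i, ∃ c : ℤ, ∀ᵐ z ∂μ, |g i z| ≤ c) ∧
      f =ᵐ[μ] fun z => ∑ i, (g i (γ i • z) - g i z)) :
    f =ᵐ[μ] (0 : Z → ℤ) := by
  obtain ⟨b, hb⟩ := hfbdd
  obtain ⟨k, g, γ, hg, hgbdd, hfg⟩ := hfsub
  have key (i : Fin k) := integral_mul_comp_sub_eq_zero (hact (γ i))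
    (f := fun z => (f z : ℝ)) (g := fun z => (g i z : ℝ))
    (by filter_upwards [hfinv (γ i)] with z hz; rw [hz])
    (by obtain ⟨c, hc⟩ := hgbdd i
        exact integrable_intCast_mul_of_ae_abs_le hfmeas (hg i) hb hc)
  have hsq : ∫ z, (f z : ℝ) * f z ∂μ = 0 := by
    have heq : (fun z => (f z : ℝ) * f z) =ᵐ[μ]
        fun z => ∑ i, (f z : ℝ) * ((g i (γ i • z) : ℝ) - g i z) := by
      filter_upwards [hfg] with z hz
      rw [← Finset.mul_sum]
      congr 1
      exact_mod_cast hz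
    rw [integral_congr_ae heq, integral_finsetSum _ fun i _ => (key i).1]
    exact Finset.sum_eq_zero fun i _ => (key i).2
  rw [integral_eq_zero_iff_of_nonneg (fun z => mul_self_nonneg _)
    (integrable_intCast_mul_of_ae_abs_le hfmeas hfmeas hb hb)] at hsq
  filter_upwards [hsq] with z hz
  simpa using hz
end
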